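/- arXiv:1901.08218 — 2 statements merged into one kernel-verified Lean document; each statement's English description precedes it below -/
import Mathlib

section
/- Let Ū : (−1,1) → ℝ be continuous with constants u₋ > 2, u₊ > −2, α ∈ (0,1], C₀ > 0 such that |Ū(x) − u₋| ≤ C₀(1+x)^α on (−1,0] and |Ū(x) − u₊| ≤ C₀(1−x)^α on [0,1). Let ε ∈ (0,1/2) satisfy 4ε > max{−u₊, 0}, and let ξ : (−1,1) → ℝ be continuous with |ξ(x)| ≤ N(1−x²)^{1−2ε} for all x. Then the integral ∫_{−1}^{x} e^{a(s)} |ξ(s)|/(1−s²) ds is finite for every x ∈ (−1,1), the function W(x) := e^{−a(x)} ∫_{−1}^{x} e^{a(s)} ξ(s)/(1−s²) ds is C¹ on (−1,1) and satisfies (1−x²)W'(x) + (2x + Ū(x))W(x) = ξ(x), and there exists C > 0 depending only on ε, u₋, u₊, α, C₀ such that |W(x)| ≤ C·N·(1−x²)^{1−2ε} for all x ∈ (−1,1). -/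
open Set Filter MeasureTheory

/-- `a(x) = ∫₀ˣ (2s + Ū(s))/(1−s²) ds`. -/
noncomputable def aF (U : ℝ → ℝ) (x : ℝ) : ℝ := ∫ s in (0:ℝ)..x, (2*s + U s) / (1 - s^2)

/-- The fundamental theorem of calculus at an interior point of an open interval of continuity. -/
lemma hasDerivAt_integral_of_continuousOn_Ioo {f : ℝ → ℝ} {a b c x : ℝ}
    (hf : ContinuousOn f (Ioo a b)) (hx : x ∈ Ioo a b) (hi : IntervalIntegrable f volume c x) :
    HasDerivAt (fun y => ∫ s in c..y, f s) (f x) x :=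
  intervalIntegral.integral_hasDerivAt_right hi
    (hf.stronglyMeasurableAtFilter isOpen_Ioo x hx) (hf.continuousAt (isOpen_Ioo.mem_nhds hx))

lemma one_sub_sq_pos {x : ℝ} (hx : x ∈ Ioo (-1:ℝ) 1) : 0 < 1 - x^2 := by
  nlinarith [hx.1, hx.2]

lemma hasDerivAt_aF {U : ℝ → ℝ} (hU : ContinuousOn U (Ioo (-1:ℝ) 1)) {x : ℝ}
    (hx : x ∈ Ioo (-1:ℝ) 1) : HasDerivAt (aF U) ((2*x + U x) / (1 - x^2)) x := by
  have hf : ContinuousOn (fun s : ℝ => (2*s + U s) / (1 - s^2)) (Ioo (-1:ℝ) 1) :=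
    ContinuousOn.div (by fun_prop) (by fun_prop) fun s hs => (one_sub_sq_pos hs).ne'
  refine hasDerivAt_integral_of_continuousOn_Ioo hf hx (hf.mono ?_).intervalIntegrable
  exact (convex_Ioo (-1:ℝ) 1).ordConnected.uIcc_subset (by norm_num) hx

/-- If `|f'| ≤ M (1 - x)^(α - 1)` on `[0, 1)` and `f 0 = 0`, then `f ≤ M / α` there. -/
lemma le_div_of_deriv_le {f f' : ℝ → ℝ} {M α : ℝ} (hα : 0 < α) (hM : 0 ≤ M) (h0 : f 0 = 0)
    (hf : ∀ x ∈ Ico (0:ℝ) 1, HasDerivAt f (f' x) x)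
    (hle : ∀ x ∈ Ico (0:ℝ) 1, f' x ≤ M * (1 - x)^(α - 1)) {x : ℝ} (hx : x ∈ Ico (0:ℝ) 1) :
    f x ≤ M / α := by
  have hg : ∀ y ∈ Ico (0:ℝ) 1, HasDerivAt (fun y => f y + M / α * (1 - y)^α)
      (f' y - M * (1 - y)^(α - 1)) y := by
    intro y hy
    have h1 : HasDerivAt (fun y : ℝ => 1 - y) (-1) y := by
      simpa using (hasDerivAt_id y).const_sub 1
    have h2 := h1.rpow_const (p := α) (Or.inl (sub_pos.2 hy.2).ne')
    refine ((hf y hy).add (h2.const_mul (M / α))).congr_deriv ?_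
    field_simp
    ring
  have hanti : AntitoneOn (fun y => f y + M / α * (1 - y)^α) (Ico 0 1) := by
    refine antitoneOn_of_hasDerivWithinAt_nonpos (convex_Ico 0 1)
      (fun y hy => (hg y hy).continuousAt.continuousWithinAt)
      (fun y hy => (hg y (interior_subset hy)).hasDerivWithinAt)
      fun y hy => sub_nonpos.2 (hle y (interior_subset hy))
  have := hanti (by norm_num : (0:ℝ) ∈ Ico (0:ℝ) 1) hx hx.1
  simp only [h0, sub_zero, Real.one_rpow, mul_one, zero_add] at this
  have h3 : 0 ≤ M / α * (1 - x)^α :=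
    mul_nonneg (by positivity) (Real.rpow_nonneg (by linarith [hx.2]) _)
  linarith

/-- Two-sided version of `le_div_of_deriv_le`. -/
lemma abs_le_div_of_abs_deriv_le {f f' : ℝ → ℝ} {M α : ℝ} (hα : 0 < α) (hM : 0 ≤ M)
    (h0 : f 0 = 0) (hf : ∀ x ∈ Ico (0:ℝ) 1, HasDerivAt f (f' x) x)
    (hle : ∀ x ∈ Ico (0:ℝ) 1, |f' x| ≤ M * (1 - x)^(α - 1)) {x : ℝ} (hx : x ∈ Ico (0:ℝ) 1) :
    |f x| ≤ M / α := by
  refine abs_le'.2 ⟨le_div_of_deriv_le hα hM h0 hf (fun y hy => (le_abs_self _).trans (hle y hy)) hx,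
    le_div_of_deriv_le (f := fun y => -f y) hα hM (by simp [h0]) (fun y hy => (hf y hy).neg)
      (fun y hy => (neg_le_abs _).trans (hle y hy)) hx⟩

/-- A perturbation `r` that is `O(t^α)` gives a quotient `r / (1 - x²)` that is `O(t^(α-1))`,
where `t` is the distance from `x` to the nearest endpoint. -/
lemma abs_div_one_sub_sq_le {u v k C₀ α t x : ℝ} (ht : 0 < t) (ht1 : t ≤ 1) (hα1 : α ≤ 1)
    (hC₀ : 0 < C₀) (htx : t ≤ 1 - x^2) (hu : |u - v| ≤ C₀ * t^α) {r : ℝ}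
    (hr : r = u - v + t * k) :
    |r / (1 - x^2)| ≤ (C₀ + |k|) * t^(α - 1) := by
  have hpos : 0 < 1 - x^2 := ht.trans_le htx
  have htα : t ≤ t^α := by
    simpa using Real.rpow_le_rpow_of_exponent_ge ht ht1 hα1
  rw [abs_div, abs_of_pos hpos, Real.rpow_sub_one ht.ne', ← mul_div_assoc]
  have hk : |t * k| ≤ |k| * t^α := by
    rw [abs_mul, abs_of_pos ht, mul_comm]
    gcongr
  have habs : |r| ≤ (C₀ + |k|) * t^α := by
    rw [hr]
    linarith [abs_add_le (u - v) (t * k)]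
  gcongr

/-- `aF U` agrees up to a bounded error with the logarithm of
`(1 + x)^(u₋/2 - 1) (1 - x)^(-u₊/2 - 1)`. -/
lemma abs_aF_sub_log_le {U : ℝ → ℝ} {um up α C₀ : ℝ} (hα : 0 < α) (hα1 : α ≤ 1) (hC₀ : 0 < C₀)
    (hU : ContinuousOn U (Ioo (-1:ℝ) 1))
    (hm : ∀ x ∈ Ioc (-1:ℝ) 0, |U x - um| ≤ C₀ * (1+x) ^ α)
    (hp : ∀ x ∈ Ico (0:ℝ) 1, |U x - up| ≤ C₀ * (1-x) ^ α) {x : ℝ} (hx : x ∈ Ioo (-1:ℝ) 1) :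
    |aF U x - ((um/2 - 1) * Real.log (1 + x) + (-up/2 - 1) * Real.log (1 - x))|
      ≤ (C₀ + |(um - up)/2|) / α := by
  set D : ℝ → ℝ := fun x =>
    aF U x - ((um/2 - 1) * Real.log (1 + x) + (-up/2 - 1) * Real.log (1 - x)) with hD
  have hD0 : D 0 = 0 := by simp [hD, aF]
  have hM : 0 ≤ C₀ + |(um - up)/2| := by positivity
  have hderiv : ∀ y ∈ Ioo (-1:ℝ) 1,
      HasDerivAt D ((U y - (um + up)/2 + y * ((um - up)/2)) / (1 - y^2)) y := by
    intro y hy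
    have h1 : 1 + y ≠ 0 := (by linarith [hy.1] : 0 < 1 + y).ne'
    have h2 : 1 - y ≠ 0 := (sub_pos.2 hy.2).ne'
    have h3 : (1 - y^2) = (1 + y) * (1 - y) := by ring
    have e1 := (((hasDerivAt_id y).const_add 1).log h1).const_mul (um/2 - 1)
    have e2 := (((hasDerivAt_id y).const_sub 1).log h2).const_mul (-up/2 - 1)
    refine ((hasDerivAt_aF hU hy).sub (e1.add e2)).congr_deriv ?_
    simp only [id_eq, h3]
    field_simp
    ring
  rcases le_total 0 x with h | h
  · refine abs_le_div_of_abs_deriv_le (f := D) hα hM hD0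
      (fun y hy => hderiv y ⟨by linarith [hy.1], hy.2⟩) (fun y hy => ?_) ⟨h, hx.2⟩
    have := abs_div_one_sub_sq_le (k := -((um - up)/2)) (t := 1 - y) (x := y) (by linarith [hy.2])
      (by linarith [hy.1]) hα1 hC₀ (by nlinarith [hy.1, hy.2]) (hp y hy)
      (r := U y - (um + up)/2 + y * ((um - up)/2)) (by ring)
    rwa [abs_neg] at this
  · have hneg : ∀ y ∈ Ico (0:ℝ) 1, -y ∈ Ioc (-1:ℝ) 0 := fun y hy =>
      ⟨by linarith [hy.2], by linarith [hy.1]⟩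
    have := abs_le_div_of_abs_deriv_le (f := fun y => D (-y))
      (f' := fun y => -((U (-y) - (um + up)/2 + (-y) * ((um - up)/2)) / (1 - (-y)^2)))
      hα hM (by simpa using hD0) (fun y hy => ?_) (fun y hy => ?_)
      (x := -x) ⟨by linarith, by linarith [hx.1]⟩
    · simpa using this
    · exact ((hderiv (-y) ⟨(hneg y hy).1, by linarith [hy.1]⟩).scomp y
        (hasDerivAt_neg y)).congr_deriv (by simp)
    · rw [abs_neg]
      have := hm (-y) (hneg y hy)
      rw [← sub_eq_add_neg] at this
      exact abs_div_one_sub_sq_le (t := 1 - y) (x := -y) (by linarith [hy.2])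
        (by linarith [hy.1]) hα1 hC₀ (by nlinarith [hy.1, hy.2]) this (by ring)

lemma rpow_mul_rpow_eq_exp {x p q : ℝ} (hx : x ∈ Ioo (-1:ℝ) 1) :
    (1 + x)^p * (1 - x)^q = Real.exp (p * Real.log (1 + x) + q * Real.log (1 - x)) := by
  rw [Real.rpow_def_of_pos (by linarith [hx.1]), Real.rpow_def_of_pos (by linarith [hx.2]),
    ← Real.exp_add, mul_comm p, mul_comm q]

lemma hasDerivAt_rpow_mul_rpow {A B x : ℝ} (hx : x ∈ Ioo (-1:ℝ) 1) :
    HasDerivAt (fun y : ℝ => (1 + y)^A * (1 - y)^(-B))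
      ((A * (1 - x) + B * (1 + x)) * ((1 + x)^(A - 1) * (1 - x)^(-B - 1))) x := by
  have h1 : 0 < 1 + x := by linarith [hx.1]
  have h2 : 0 < 1 - x := by linarith [hx.2]
  have e1 := ((hasDerivAt_id x).const_add 1).rpow_const (p := A) (Or.inl h1.ne')
  have e2 := ((hasDerivAt_id x).const_sub 1).rpow_const (p := -B) (Or.inl h2.ne')
  refine (e1.mul e2).congr_deriv ?_
  simp only [id_eq, Real.rpow_sub_one h1.ne', Real.rpow_sub_one h2.ne']
  field_simp

/-- A function dominated by `c (1 + s)^(A-1) (1 - s)^(-B-1)` with `A, B > 0` is integrable from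
`-1`, with integral at most `c (1 + x)^A (1 - x)^(-B) / (2 min A B)`. -/
lemma integrable_and_abs_integral_le {f : ℝ → ℝ} {A B c : ℝ} (hA : 0 < A) (hB : 0 < B)
    (hc : 0 ≤ c) (hf : ContinuousOn f (Ioo (-1:ℝ) 1))
    (hle : ∀ s ∈ Ioo (-1:ℝ) 1, |f s| ≤ c * ((1 + s)^(A - 1) * (1 - s)^(-B - 1)))
    {x : ℝ} (hx : x ∈ Ioo (-1:ℝ) 1) :
    IntervalIntegrable f volume (-1) x ∧
      |∫ s in (-1:ℝ)..x, f s| ≤ c / (2 * min A B) * ((1 + x)^A * (1 - x)^(-B)) := by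
  have hm : 0 < min A B := lt_min hA hB
  set V : ℝ → ℝ := fun y => (1 + y)^A * (1 - y)^(-B) with hV
  set V' : ℝ → ℝ := fun y => (A * (1 - y) + B * (1 + y)) * ((1 + y)^(A - 1) * (1 - y)^(-B - 1))
    with hV'
  have hsub : ∀ s ∈ Ioo (-1:ℝ) x, s ∈ Ioo (-1:ℝ) 1 := fun s hs => ⟨hs.1, hs.2.trans hx.2⟩
  have hderiv : ∀ s ∈ Ioo (-1:ℝ) x, HasDerivAt V (V' s) s := fun s hs =>
    hasDerivAt_rpow_mul_rpow (hsub s hs)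
  have hcont : ContinuousOn V (Icc (-1) x) := by
    refine ContinuousOn.mul (ContinuousOn.rpow_const (by fun_prop) fun _ _ => Or.inr hA.le)
      (ContinuousOn.rpow_const (by fun_prop) fun s hs => Or.inl ?_)
    have := hs.2.trans_lt hx.2
    linarith
  have hw : ∀ s ∈ Ioo (-1:ℝ) 1, 0 ≤ (1 + s)^(A - 1) * (1 - s)^(-B - 1) := fun s hs =>
    mul_nonneg (Real.rpow_nonneg (by linarith [hs.1]) _) (Real.rpow_nonneg (by linarith [hs.2]) _)
  have hcoef : ∀ s ∈ Ioo (-1:ℝ) 1, 2 * min A B ≤ A * (1 - s) + B * (1 + s) := fun s hs => by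
    nlinarith [mul_nonneg (sub_nonneg.2 (min_le_left A B)) (sub_nonneg.2 hs.2.le),
      mul_nonneg (sub_nonneg.2 (min_le_right A B)) (sub_nonneg.2 hs.1.le)]
  have hbound : ∀ s ∈ Ioo (-1:ℝ) 1, |f s| ≤ c / (2 * min A B) * V' s := fun s hs => by
    refine (hle s hs).trans ?_
    calc c * ((1 + s)^(A - 1) * (1 - s)^(-B - 1))
        = c / (2 * min A B) * (2 * min A B * ((1 + s)^(A - 1) * (1 - s)^(-B - 1))) := by
          field_simp
      _ ≤ c / (2 * min A B) * V' s :=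
          mul_le_mul_of_nonneg_left (mul_le_mul_of_nonneg_right (hcoef s hs) (hw s hs))
            (by positivity)
  have hV'int : IntegrableOn V' (Ioc (-1) x) :=
    intervalIntegral.integrableOn_deriv_of_nonneg hcont hderiv fun s hs =>
      mul_nonneg (le_trans (by positivity) (hcoef s (hsub s hs))) (hw s (hsub s hs))
  have hIoc : ∀ s ∈ Ioc (-1:ℝ) x, s ∈ Ioo (-1:ℝ) 1 := fun s hs => ⟨hs.1, hs.2.trans_lt hx.2⟩
  have hfint : IntegrableOn f (Ioc (-1) x) := by
    refine Integrable.mono' (hV'int.const_mul (c / (2 * min A B)))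
      ((hf.mono hIoc).aestronglyMeasurable measurableSet_Ioc) ?_
    exact (ae_restrict_iff' measurableSet_Ioc).2 (.of_forall fun s hs => hbound s (hIoc s hs))
  have hV'I : IntervalIntegrable V' volume (-1) x :=
    (intervalIntegrable_iff_integrableOn_Ioc_of_le hx.1.le).2 hV'int
  refine ⟨(intervalIntegrable_iff_integrableOn_Ioc_of_le hx.1.le).2 hfint, ?_⟩
  have hV1 : V (-1) = 0 := by simp [hV, Real.zero_rpow hA.ne']
  rw [← Real.norm_eq_abs]
  calc ‖∫ s in (-1:ℝ)..x, f s‖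
      ≤ ∫ s in (-1:ℝ)..x, c / (2 * min A B) * V' s :=
        intervalIntegral.norm_integral_le_of_norm_le hx.1.le
          (ae_of_all _ fun s hs => hbound s (hIoc s hs)) (hV'I.const_mul _)
    _ = c / (2 * min A B) * V x := by
        rw [intervalIntegral.integral_const_mul,
          intervalIntegral.integral_eq_sub_of_hasDerivAt_of_le hx.1.le hcont hderiv hV'I, hV1,
          sub_zero]

/-- in the case `u₋ > 2`, `u₊ > −2`, the integral from `−1` converges and
`W(x) = e^{−a(x)} ∫_{−1}ˣ e^{a(s)} ξ(s)/(1−s²) ds` solves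
`(1−x²)W' + (2x+Ū)W = ξ` with the weighted bound `|W| ≤ C·N·(1−x²)^{1−2ε}`. -/
theorem stmt11 (um up α C₀ ε : ℝ) (hum : 2 < um) (hup : -2 < up)
    (hα : 0 < α) (hα1 : α ≤ 1) (hC₀ : 0 < C₀)
    (hε1 : 0 < ε) (hε2 : ε < 1/2) (h4ε : -up < 4*ε) :
    ∃ C > 0, ∀ (U ξ : ℝ → ℝ) (N : ℝ),
      ContinuousOn U (Ioo (-1:ℝ) 1) →
      (∀ x ∈ Ioc (-1:ℝ) 0, |U x - um| ≤ C₀ * (1+x) ^ α) →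
      (∀ x ∈ Ico (0:ℝ) 1, |U x - up| ≤ C₀ * (1-x) ^ α) →
      ContinuousOn ξ (Ioo (-1:ℝ) 1) →
      (∀ x ∈ Ioo (-1:ℝ) 1, |ξ x| ≤ N * (1-x^2) ^ (1-2*ε)) →
      (∀ x ∈ Ioo (-1:ℝ) 1,
        IntervalIntegrable (fun s => Real.exp (aF U s) * |ξ s| / (1-s^2))
          volume (-1) x) ∧
      (let W : ℝ → ℝ := fun x =>
        Real.exp (-(aF U x)) * ∫ s in (-1:ℝ)..x, Real.exp (aF U s) * ξ s / (1-s^2)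
       ∃ W' : ℝ → ℝ,
        ContinuousOn W' (Ioo (-1:ℝ) 1) ∧
        (∀ x ∈ Ioo (-1:ℝ) 1, HasDerivAt W (W' x) x) ∧
        (∀ x ∈ Ioo (-1:ℝ) 1, (1-x^2) * W' x + (2*x + U x) * W x = ξ x) ∧
        (∀ x ∈ Ioo (-1:ℝ) 1, |W x| ≤ C * N * (1-x^2) ^ (1-2*ε))) := by
  have hA : 0 < um/2 - 2*ε := by linarith
  have hB : 0 < up/2 + 2*ε := by linarith
  set A := um/2 - 2*ε with hAdef
  set B := up/2 + 2*ε with hBdef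
  set K := (C₀ + |(um - up)/2|) / α with hK
  have hm : 0 < min A B := lt_min hA hB
  refine ⟨Real.exp K * Real.exp K / (2 * min A B), by positivity, ?_⟩
  intro U ξ N hU hUm hUp hξ hξN
  have hN : 0 ≤ N := by
    have := (abs_nonneg _).trans (hξN 0 (by norm_num))
    simpa using this
  have haF : ContinuousOn (aF U) (Ioo (-1:ℝ) 1) := fun x hx =>
    (hasDerivAt_aF hU hx).continuousAt.continuousWithinAt
  have hlog : ∀ {x : ℝ}, x ∈ Ioo (-1:ℝ) 1 → ∀ p : ℝ,
      (1 - x^2)^p = (1 + x)^p * (1 - x)^p := fun {x} hx p => by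
    rw [← Real.mul_rpow (by linarith [hx.1]) (by linarith [hx.2])]
    ring_nf
  have hexp : ∀ x ∈ Ioo (-1:ℝ) 1, Real.exp (aF U x) ≤
      Real.exp K * ((1 + x)^(um/2 - 1) * (1 - x)^(-up/2 - 1)) := fun x hx => by
    rw [rpow_mul_rpow_eq_exp hx, ← Real.exp_add, Real.exp_le_exp]
    linarith [(abs_le.1 (abs_aF_sub_log_le hα hα1 hC₀ hU hUm hUp hx)).2]
  have hexp_neg : ∀ x ∈ Ioo (-1:ℝ) 1, Real.exp (-aF U x) ≤
      Real.exp K * ((1 + x)^(-(um/2 - 1)) * (1 - x)^(-(-up/2 - 1))) := fun x hx => by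
    rw [rpow_mul_rpow_eq_exp hx, ← Real.exp_add, Real.exp_le_exp]
    linarith [(abs_le.1 (abs_aF_sub_log_le hα hα1 hC₀ hU hUm hUp hx)).1]
  have hf : ContinuousOn (fun s => Real.exp (aF U s) * ξ s / (1 - s^2)) (Ioo (-1:ℝ) 1) :=
    ContinuousOn.div (haF.rexp.mul hξ) (by fun_prop) fun s hs => (one_sub_sq_pos hs).ne'
  have hle : ∀ s ∈ Ioo (-1:ℝ) 1, |Real.exp (aF U s) * ξ s / (1 - s^2)| ≤
      (Real.exp K * N) * ((1 + s)^(A - 1) * (1 - s)^(-B - 1)) := fun s hs => by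
    have h1 : 0 < 1 + s := by linarith [hs.1]
    have h2 : 0 < 1 - s := by linarith [hs.2]
    have h3 := one_sub_sq_pos hs
    rw [abs_div, abs_mul, abs_of_pos (Real.exp_pos _), abs_of_pos h3]
    calc Real.exp (aF U s) * |ξ s| / (1 - s^2)
        ≤ (Real.exp K * ((1 + s)^(um/2 - 1) * (1 - s)^(-up/2 - 1))) *
            (N * (1 - s^2)^(1 - 2*ε)) / (1 - s^2) := by
          gcongr
          · exact hexp s hs
          · exact hξN s hs
      _ = (Real.exp K * N) * (((1 + s)^(um/2 - 1) * (1 - s)^(-up/2 - 1)) *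
            (1 - s^2)^(1 - 2*ε - 1)) := by
          rw [Real.rpow_sub_one h3.ne']
          ring
      _ = (Real.exp K * N) * ((1 + s)^(A - 1) * (1 - s)^(-B - 1)) := by
          rw [hlog hs, mul_mul_mul_comm ((1 + s)^_), ← Real.rpow_add h1, ← Real.rpow_add h2]
          congr 3 <;> simp only [hAdef, hBdef] <;> ring
  have hmain := fun {x : ℝ} (hx : x ∈ Ioo (-1:ℝ) 1) =>
    integrable_and_abs_integral_le hA hB (by positivity) hf hle hx
  refine ⟨fun x hx => ?_, ?_⟩
  · refine (hmain hx).1.abs.congr_uIoo fun s hs => ?_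
    rw [uIoo_of_le hx.1.le] at hs
    have h3 := one_sub_sq_pos (x := s) ⟨hs.1, hs.2.trans hx.2⟩
    simp only [abs_div, abs_mul, abs_of_pos (Real.exp_pos _), abs_of_pos h3]
  intro W
  have hW : ∀ x ∈ Ioo (-1:ℝ) 1,
      HasDerivAt W ((ξ x - (2*x + U x) * W x) / (1 - x^2)) x := fun x hx => by
    have h3 := (one_sub_sq_pos hx).ne'
    have e1 := (hasDerivAt_aF hU hx).neg.exp
    have e2 := hasDerivAt_integral_of_continuousOn_Ioo hf hx (hmain hx).1
    refine (e1.mul e2).congr_deriv ?_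
    have h4 : Real.exp (-aF U x) * Real.exp (aF U x) = 1 := by simp [← Real.exp_add]
    simp only [W, Pi.neg_apply]
    linear_combination (ξ x / (1 - x^2)) * h4
  refine ⟨fun x => (ξ x - (2*x + U x) * W x) / (1 - x^2), ?_, hW, fun x hx => ?_, fun x hx => ?_⟩
  · have hWc : ContinuousOn W (Ioo (-1:ℝ) 1) := fun x hx =>
      (hW x hx).continuousAt.continuousWithinAt
    exact ContinuousOn.div (by fun_prop) (by fun_prop) fun s hs => (one_sub_sq_pos hs).ne'
  · have h3 := (one_sub_sq_pos hx).ne'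
    field_simp
    ring
  · have h1 : 0 < 1 + x := by linarith [hx.1]
    have h2 : 0 < 1 - x := by linarith [hx.2]
    simp only [W]
    rw [abs_mul, abs_of_pos (Real.exp_pos _)]
    calc _ ≤ (Real.exp K * ((1 + x)^(-(um/2 - 1)) * (1 - x)^(-(-up/2 - 1)))) *
          (Real.exp K * N / (2 * min A B) * ((1 + x)^A * (1 - x)^(-B))) :=
          mul_le_mul (hexp_neg x hx) (hmain hx).2 (abs_nonneg _) (by positivity)
      _ = Real.exp K * Real.exp K / (2 * min A B) * N *
          (((1 + x)^(-(um/2 - 1)) * (1 - x)^(-(-up/2 - 1))) * ((1 + x)^A * (1 - x)^(-B))) := by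
          ring
      _ = _ := by
          rw [hlog hx, mul_mul_mul_comm ((1 + x)^_), ← Real.rpow_add h1, ← Real.rpow_add h2]
          congr 3 <;> simp only [hAdef, hBdef] <;> ring
end

section
/- Let Ū : (−1,1) → ℝ be continuous with constants u₋ > 2, u₊ < −2, α ∈ (0,1], C₀ > 0 such that |Ū(x) − u₋| ≤ C₀(1+x)^α on (−1,0] and |Ū(x) − u₊| ≤ C₀(1−x)^α on [0,1). Then ∫_{−1}^{1} e^{a(s)} ds is finite and strictly positive, and if d₁, d₂ ∈ ℝ are such that the function v(x) = e^{−a(x)}(d₁ + d₂ ∫₀ˣ e^{a(s)} ds) extends continuously to [−1,1] with v(−1) = v(1) = 0, then d₁ = d₂ = 0. -/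
open Set Filter MeasureTheory

lemma continuousOn_integrand {U : ℝ → ℝ} (hUc : ContinuousOn U (Ioo (-1:ℝ) 1)) :
    ContinuousOn (fun s => (2*s + U s) / (1 - s^2)) (Ioo (-1:ℝ) 1) := by
  refine ContinuousOn.div (by fun_prop) (by fun_prop) fun x hx => ?_
  nlinarith [hx.1, hx.2]

/-- If `|U - up| ≤ C₀ (1 - x)^α` on `[0, 1)` with `up < -2`, the integrand of `aF` is bounded above
on `[0, 1)`. -/
lemma exists_integrand_le {U : ℝ → ℝ} {up α C₀ : ℝ} (hup : up < -2) (hα : 0 < α)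
    (hUc : ContinuousOn U (Ioo (-1:ℝ) 1))
    (hplus : ∀ x ∈ Ico (0:ℝ) 1, |U x - up| ≤ C₀ * (1-x) ^ α) :
    ∃ K : ℝ, 0 ≤ K ∧ ∀ x ∈ Ico (0:ℝ) 1, (2*x + U x) / (1 - x^2) ≤ K := by
  have hlim : ∀ᶠ x : ℝ in nhds 1, C₀ * (1-x) ^ α < -2 - up := by
    have hc : Continuous fun x : ℝ => C₀ * (1-x) ^ α :=
      continuous_const.mul ((continuous_const.sub continuous_id).rpow_const fun _ => Or.inr hα.le)
    refine (hc.tendsto 1).eventually_lt_const ?_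
    simp only [sub_self, Real.zero_rpow hα.ne', mul_zero]
    linarith
  obtain ⟨ε, hε, hlt⟩ := Metric.eventually_nhds_iff.1 hlim
  have hsub : Icc (0:ℝ) (1 - ε/2) ⊆ Ioo (-1:ℝ) 1 := fun x hx =>
    ⟨by linarith [hx.1], by linarith [hx.2]⟩
  obtain ⟨K, hK⟩ := (isCompact_Icc (a := (0:ℝ)) (b := 1 - ε/2)).bddAbove_image
    ((continuousOn_integrand hUc).mono hsub)
  refine ⟨max K 0, le_max_right _ _, fun x hx => ?_⟩
  rcases le_or_gt x (1 - ε/2) with h | h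
  · exact (hK (mem_image_of_mem _ ⟨hx.1, h⟩)).trans (le_max_left _ _)
  · refine le_trans ?_ (le_max_right _ _)
    have h1 := hlt (y := x) (by rw [Real.dist_eq, abs_lt]; constructor <;> linarith [hx.2])
    have h2 := (abs_le.1 (hplus x hx)).2
    exact div_nonpos_of_nonpos_of_nonneg (by linarith [hx.2]) (by nlinarith [hx.1, hx.2])

lemma intervalIntegrable_integrand {U : ℝ → ℝ} (hUc : ContinuousOn U (Ioo (-1:ℝ) 1)) {x y : ℝ}
    (hx : x ∈ Ioo (-1:ℝ) 1) (hy : y ∈ Ioo (-1:ℝ) 1) :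
    IntervalIntegrable (fun s => (2*s + U s) / (1 - s^2)) volume x y :=
  ((continuousOn_integrand hUc).mono (ordConnected_Ioo.uIcc_subset hx hy)).intervalIntegrable

lemma continuousOn_aF {U : ℝ → ℝ} (hUc : ContinuousOn U (Ioo (-1:ℝ) 1)) :
    ContinuousOn (aF U) (Ioo (-1:ℝ) 1) := fun x hx =>
  (intervalIntegral.integral_hasDerivAt_right
    (intervalIntegrable_integrand hUc (by norm_num) hx)
    ((continuousOn_integrand hUc).stronglyMeasurableAtFilter isOpen_Ioo x hx)
    ((continuousOn_integrand hUc).continuousAt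
      (isOpen_Ioo.mem_nhds hx))).continuousAt.continuousWithinAt

/-- Under the right-endpoint hypothesis, `aF U` is bounded above on `[0, 1)`. -/
lemma exists_aF_le {U : ℝ → ℝ} {up α C₀ : ℝ} (hup : up < -2) (hα : 0 < α)
    (hUc : ContinuousOn U (Ioo (-1:ℝ) 1))
    (hplus : ∀ x ∈ Ico (0:ℝ) 1, |U x - up| ≤ C₀ * (1-x) ^ α) :
    ∃ K : ℝ, ∀ x ∈ Ico (0:ℝ) 1, aF U x ≤ K := by
  obtain ⟨K, hK0, hK⟩ := exists_integrand_le hup hα hUc hplus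
  refine ⟨K, fun x hx => ?_⟩
  have h := intervalIntegral.integral_mono_on hx.1
    (intervalIntegrable_integrand hUc (by norm_num) ⟨by linarith [hx.1], hx.2⟩)
    (intervalIntegrable_const (c := K)) fun s hs => hK s ⟨hs.1, hs.2.trans_lt hx.2⟩
  rw [intervalIntegral.integral_const, smul_eq_mul] at h
  unfold aF
  nlinarith [hx.1, hx.2]

/-- Reflecting `U` to `-U(-·)` reflects `aF U`. -/
lemma aF_reflect (U : ℝ → ℝ) (x : ℝ) : aF (fun s => -U (-s)) x = aF U (-x) := by
  unfold aF
  have h := intervalIntegral.integral_comp_neg (a := 0) (b := x)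
    (fun s => (2*s + U s) / (1 - s^2))
  rw [neg_zero] at h
  rw [intervalIntegral.integral_symm (-x) 0, ← h, ← intervalIntegral.integral_neg]
  congr 1
  ext s
  rw [neg_sq, ← neg_div]
  ring

/-- in the case `u₋ > 2`, `u₊ < −2`, `∫₋₁¹ e^{a}` is finite and positive,
and the only combination `e^{−a}(d₁ + d₂∫₀ˣ e^{a})` extending continuously to `[−1,1]`
with value `0` at `±1` is the trivial one. -/
theorem stmt17 (U : ℝ → ℝ) (um up α C₀ : ℝ) (hum : 2 < um) (hup : up < -2)
    (hα : 0 < α) (hα1 : α ≤ 1) (hC₀ : 0 < C₀)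
    (hUc : ContinuousOn U (Ioo (-1:ℝ) 1))
    (hminus : ∀ x ∈ Ioc (-1:ℝ) 0, |U x - um| ≤ C₀ * (1+x) ^ α)
    (hplus : ∀ x ∈ Ico (0:ℝ) 1, |U x - up| ≤ C₀ * (1-x) ^ α) :
    IntervalIntegrable (fun s => Real.exp (aF U s)) volume (-1) 1 ∧
    (0 < ∫ s in (-1:ℝ)..1, Real.exp (aF U s)) ∧
    ∀ d₁ d₂ : ℝ,
      (∃ v : ℝ → ℝ, ContinuousOn v (Icc (-1:ℝ) 1) ∧
        (∀ x ∈ Ioo (-1:ℝ) 1,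
          v x = Real.exp (-(aF U x)) * (d₁ + d₂ * ∫ s in (0:ℝ)..x, Real.exp (aF U s))) ∧
        v (-1) = 0 ∧ v 1 = 0) →
      d₁ = 0 ∧ d₂ = 0 := by
  have hbound : ∃ K : ℝ, ∀ x ∈ Ioo (-1:ℝ) 1, aF U x ≤ K := by
    obtain ⟨K₁, hK₁⟩ := exists_aF_le hup hα hUc hplus
    obtain ⟨K₂, hK₂⟩ := exists_aF_le (U := fun s => -U (-s)) (up := -um) (by linarith) hα
      (hUc.comp continuousOn_neg fun x hx => ⟨by linarith [hx.2], by linarith [hx.1]⟩).neg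
      (fun x hx => by
        have h := hminus (-x) ⟨by linarith [hx.2], by linarith [hx.1]⟩
        rwa [← sub_eq_add_neg, abs_sub_comm, sub_eq_neg_add, ← sub_neg_eq_add] at h)
    refine ⟨max K₁ K₂, fun x hx => ?_⟩
    rcases le_total 0 x with h | h
    · exact (hK₁ x ⟨h, hx.2⟩).trans (le_max_left _ _)
    · have := hK₂ (-x) ⟨by linarith, by linarith [hx.1]⟩
      rw [aF_reflect, neg_neg] at this
      exact this.trans (le_max_right _ _)
  obtain ⟨K, hK⟩ := hbound
  have hint : IntervalIntegrable (fun s => Real.exp (aF U s)) volume (-1) 1 := by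
    rw [intervalIntegrable_iff_integrableOn_Ioo_of_le (by norm_num)]
    refine IntegrableOn.of_bound (by simp)
      ((continuousOn_aF hUc).rexp.aestronglyMeasurable measurableSet_Ioo) (Real.exp K) ?_
    filter_upwards [ae_restrict_mem measurableSet_Ioo] with x hx
    rw [Real.norm_eq_abs, Real.abs_exp]
    exact Real.exp_le_exp.2 (hK x hx)
  have hpos : 0 < ∫ s in (-1:ℝ)..1, Real.exp (aF U s) :=
    intervalIntegral.intervalIntegral_pos_of_pos hint (fun x => Real.exp_pos _) (by norm_num)
  refine ⟨hint, hpos, ?_⟩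
  rintro d₁ d₂ ⟨v, hv, hveq, hvm, hvp⟩
  have hprim : ContinuousOn (fun x => d₁ + d₂ * ∫ s in (0:ℝ)..x, Real.exp (aF U s))
      (Icc (-1:ℝ) 1) := by
    have h := intervalIntegral.continuousOn_primitive_interval' hint (a := 0)
      (by rw [uIcc_of_le (by norm_num)]; norm_num)
    rw [uIcc_of_le (by norm_num)] at h
    exact continuousOn_const.add (continuousOn_const.mul h)
  have hzero : ∀ e ∈ Icc (-1:ℝ) 1, v e = 0 →
      d₁ + d₂ * ∫ s in (0:ℝ)..e, Real.exp (aF U s) = 0 := by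
    intro e he hve
    have hcl : e ∈ closure (Ioo (-1:ℝ) 1) := by rwa [closure_Ioo (by norm_num)]
    have : (nhdsWithin e (Ioo (-1:ℝ) 1)).NeBot := mem_closure_iff_nhdsWithin_neBot.1 hcl
    have h₁ := (hprim e he).mono Ioo_subset_Icc_self
    have h₂ : Tendsto v (nhdsWithin e (Ioo (-1:ℝ) 1)) (nhds 0) := by
      simpa [hve] using ((hv e he).mono Ioo_subset_Icc_self).tendsto
    refine tendsto_nhds_unique h₁.tendsto (squeeze_zero_norm' (a := fun x => Real.exp K * |v x|)
      ?_ (by simpa using h₂.abs.const_mul (Real.exp K)))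
    filter_upwards [self_mem_nhdsWithin] with x hx
    have hx' : d₁ + d₂ * ∫ s in (0:ℝ)..x, Real.exp (aF U s) = Real.exp (aF U x) * v x := by
      rw [hveq x hx, ← mul_assoc, ← Real.exp_add, add_neg_cancel, Real.exp_zero, one_mul]
    rw [hx', Real.norm_eq_abs, abs_mul, Real.abs_exp]
    exact mul_le_mul_of_nonneg_right (Real.exp_le_exp.2 (hK x hx)) (abs_nonneg _)
  have hp := hzero 1 (by norm_num) hvp
  have hm := hzero (-1) (by norm_num) hvm
  have hsplit : (∫ s in (-1:ℝ)..1, Real.exp (aF U s)) =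
      (∫ s in (0:ℝ)..1, Real.exp (aF U s)) - ∫ s in (0:ℝ)..(-1), Real.exp (aF U s) := by
    refine (intervalIntegral.integral_interval_sub_left ?_ ?_).symm <;>
    · refine hint.mono_set (ordConnected_uIcc.uIcc_subset ?_ ?_) <;>
        rw [uIcc_of_le (by norm_num)] <;> norm_num
  have hd : d₂ = 0 := by
    have : d₂ * ∫ s in (-1:ℝ)..1, Real.exp (aF U s) = 0 := by
      rw [hsplit]; linear_combination hp - hm
    exact (mul_eq_zero.1 this).resolve_right hpos.ne'
  exact ⟨by simpa [hd] using hp, hd⟩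
end
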